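/- Let ε > 0. If an undirected multigraph G = (V,E) on n vertices contains no vertex subset X with |X| ≤ 4·(1 + 1/ε)·log₂(n) such that G[X] has more edges than vertices, then |E| ≤ (1+ε)·|V|. -/

import Mathlib

/-- The edges of the multigraph `ends` having both endpoints in `X`. -/
def inducedEdges {V ι : Type*} [DecidableEq V] [Fintype ι] (ends : ι → V × V)
    (X : Finset V) : Finset ι :=
  Finset.univ.filter (fun e : ι => (ends e).1 ∈ X ∧ (ends e).2 ∈ X)

/-- `B` is spanned by a tree rooted at `v` of depth at most `r`: `p` assigns to each vertex of `B`
other than `v` its parent edge, and each vertex has a set of at most `r` non-root ancestors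
(including itself) that is closed under taking parent edges. -/
def IsRootedBall {V ι : Type*} [DecidableEq V] (ends : ι → V × V) (v : V)
    (B : Finset V) (r : ℕ) : Prop :=
  v ∈ B ∧ ∃ p : V → ι, Set.InjOn p (B.erase v) ∧
    (∀ u ∈ B, u ≠ v → (ends (p u)).1 ∈ B ∧ (ends (p u)).2 ∈ B) ∧
    ∀ u ∈ B, ∃ A : Finset V, A ⊆ B ∧ v ∉ A ∧ u ∈ insert v A ∧ A.card ≤ r ∧
      ∀ w ∈ A, (ends (p w)).1 ∈ insert v A ∧ (ends (p w)).2 ∈ insert v A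

section RootedBall

variable {V ι : Type*} [DecidableEq V] {ends : ι → V × V} {v : V}

theorem isRootedBall_singleton [Nonempty ι] : IsRootedBall ends v {v} 0 := by
  refine ⟨by simp, fun _ => Classical.arbitrary ι, by simp, by simp, fun u hu => ⟨∅, ?_⟩⟩
  simp_all

theorem IsRootedBall.extend {B B' : Finset V} {r : ℕ} (h : IsRootedBall ends v B r)
    (hBB' : B ⊆ B')
    (hnew : ∀ u ∈ B', u ∉ B → ∃ e, ∃ b ∈ B, ends e = (u, b) ∨ ends e = (b, u)) :
    IsRootedBall ends v B' (r + 1) := by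
  obtain ⟨hv, p, hinj, hpB, hA⟩ := h
  have hι : Nonempty ι ∨ ∀ u ∈ B', u ∈ B := by
    by_contra! hcon
    obtain ⟨hι, u, hu, huB⟩ := hcon
    obtain ⟨e, -⟩ := hnew u hu huB
    exact hι.elim e
  have hg : ∃ g : V → ι, ∀ u ∈ B', u ∉ B → ∃ b ∈ B, ends (g u) = (u, b) ∨ ends (g u) = (b, u) := by
    rcases hι with hι | hsub
    · have : ∀ u, ∃ e, u ∈ B' → u ∉ B → ∃ b ∈ B, ends e = (u, b) ∨ ends e = (b, u) := by
        intro u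
        by_cases hu : u ∈ B' ∧ u ∉ B
        · obtain ⟨e, he⟩ := hnew u hu.1 hu.2
          exact ⟨e, fun _ _ => he⟩
        · exact ⟨Classical.arbitrary ι, fun h1 h2 => (hu ⟨h1, h2⟩).elim⟩
      choose g hg using this
      exact ⟨g, hg⟩
    · exact ⟨p, fun u hu huB => (huB (hsub u hu)).elim⟩
  obtain ⟨g, hg⟩ := hg
  refine ⟨hBB' hv, fun u => if u ∈ B then p u else g u, ?_, ?_, ?_⟩
  · intro x hx y hy hxy
    simp only [Finset.coe_erase, Set.mem_sdiff, Finset.mem_coe, Set.mem_singleton_iff] at hx hy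
    by_cases hxB : x ∈ B <;> by_cases hyB : y ∈ B <;> simp only [hxB, hyB, if_true, if_false] at hxy
    · exact hinj (by simp [hxB, hx.2]) (by simp [hyB, hy.2]) hxy
    · obtain ⟨b, hb, h1⟩ := hg y hy.1 hyB
      have h2 := hpB x hxB hx.2
      rw [hxy] at h2
      rcases h1 with h1 | h1 <;> rw [h1] at h2 <;> simp_all
    · obtain ⟨b, hb, h1⟩ := hg x hx.1 hxB
      have h2 := hpB y hyB hy.2
      rw [← hxy] at h2
      rcases h1 with h1 | h1 <;> rw [h1] at h2 <;> simp_all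
    · obtain ⟨b, hb, h1⟩ := hg x hx.1 hxB
      obtain ⟨c, hc, h2⟩ := hg y hy.1 hyB
      rw [hxy] at h1
      rcases h1 with h1 | h1 <;> rcases h2 with h2 | h2 <;> rw [h1] at h2 <;>
        simp only [Prod.mk.injEq] at h2
      · exact h2.1
      · exact (hxB (h2.1 ▸ hc)).elim
      · exact (hxB (h2.2 ▸ hc)).elim
      · exact h2.2
  · intro u hu huv
    by_cases huB : u ∈ B
    · simp only [huB, if_true]
      exact ⟨hBB' (hpB u huB huv).1, hBB' (hpB u huB huv).2⟩
    · simp only [huB, if_false]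
      obtain ⟨b, hb, h1⟩ := hg u hu huB
      rcases h1 with h1 | h1 <;> rw [h1] <;> simp [hu, hBB' hb]
  · intro u hu
    by_cases huB : u ∈ B
    · obtain ⟨A, hAB, hvA, huA, hcard, hcl⟩ := hA u huB
      refine ⟨A, hAB.trans hBB', hvA, huA, by omega, fun w hw => ?_⟩
      simp only [hAB hw, if_true]
      exact hcl w hw
    · obtain ⟨b, hb, h1⟩ := hg u hu huB
      obtain ⟨A, hAB, hvA, hbA, hcard, hcl⟩ := hA b hb
      have huv : v ≠ u := fun h => huB (h ▸ hv)
      refine ⟨insert u A, ?_, by simp [huv, hvA], by simp, ?_, fun w hw => ?_⟩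
      · exact Finset.insert_subset hu (hAB.trans hBB')
      · exact (Finset.card_insert_le _ _).trans (by omega)
      · have hsub : insert v A ⊆ insert v (insert u A) :=
          Finset.insert_subset_insert _ (Finset.subset_insert _ _)
        by_cases hwA : w ∈ A
        · simp only [hAB hwA, if_true]
          exact ⟨hsub (hcl w hwA).1, hsub (hcl w hwA).2⟩
        · obtain rfl : w = u := by simpa [hwA] using hw
          simp only [huB, if_false]
          have := hsub hbA
          rcases h1 with h1 | h1 <;> rw [h1] <;> exact ⟨by simp_all, by simp_all⟩

variable [Fintype ι] [DecidableEq ι]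

/-- Two edges outside the spanning tree, together with the tree paths from their endpoints to the
root, induce a subgraph with more edges than vertices. -/
theorem IsRootedBall.exists_dense {B : Finset V} {r : ℕ} (h : IsRootedBall ends v B r)
    (hB : B.card < (inducedEdges ends B).card) :
    ∃ X : Finset V, X.card ≤ 4 * r + 1 ∧ X.card < (inducedEdges ends X).card := by
  obtain ⟨hv, p, hinj, hpB, hA⟩ := h
  have htree : ((B.erase v).image p).card + 1 = B.card := by
    rw [Finset.card_image_of_injOn hinj, Finset.card_erase_add_one hv]
  have hex : 1 < (inducedEdges ends B \ (B.erase v).image p).card := by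
    have := Finset.le_card_sdiff ((B.erase v).image p) (inducedEdges ends B)
    omega
  obtain ⟨e, he, f, hf, hef⟩ := Finset.one_lt_card.1 hex
  simp only [Finset.mem_sdiff, inducedEdges, Finset.mem_filter, Finset.mem_univ, true_and] at he hf
  obtain ⟨A₁, hB₁, hv₁, hm₁, hc₁, hcl₁⟩ := hA _ he.1.1
  obtain ⟨A₂, hB₂, hv₂, hm₂, hc₂, hcl₂⟩ := hA _ he.1.2
  obtain ⟨A₃, hB₃, hv₃, hm₃, hc₃, hcl₃⟩ := hA _ hf.1.1
  obtain ⟨A₄, hB₄, hv₄, hm₄, hc₄, hcl₄⟩ := hA _ hf.1.2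
  set U := (A₁ ∪ A₂) ∪ (A₃ ∪ A₄) with hU
  have hvU : v ∉ U := by simp [hU, hv₁, hv₂, hv₃, hv₄]
  have hUB : U ⊆ B.erase v := by
    intro w hw
    refine Finset.mem_erase.2 ⟨fun h => hvU (h ▸ hw), ?_⟩
    simp only [hU, Finset.mem_union] at hw
    rcases hw with (hw | hw) | (hw | hw)
    exacts [hB₁ hw, hB₂ hw, hB₃ hw, hB₄ hw]
  have hs₁ : insert v A₁ ⊆ insert v U := Finset.insert_subset_insert _ (by grind)
  have hs₂ : insert v A₂ ⊆ insert v U := Finset.insert_subset_insert _ (by grind)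
  have hs₃ : insert v A₃ ⊆ insert v U := Finset.insert_subset_insert _ (by grind)
  have hs₄ : insert v A₄ ⊆ insert v U := Finset.insert_subset_insert _ (by grind)
  have hUcard : U.card ≤ 4 * r := by
    have h1 := Finset.card_union_le (A₁ ∪ A₂) (A₃ ∪ A₄)
    rw [← hU] at h1
    have h2 := Finset.card_union_le A₁ A₂
    have h3 := Finset.card_union_le A₃ A₄
    omega
  refine ⟨insert v U, ?_, ?_⟩
  · rw [Finset.card_insert_of_notMem hvU]
    omega
  · have hsub : insert e (insert f (U.image p)) ⊆ inducedEdges ends (insert v U) := by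
      intro x hx
      simp only [inducedEdges, Finset.mem_filter, Finset.mem_univ, true_and]
      rcases Finset.mem_insert.1 hx with rfl | hx
      · exact ⟨hs₁ hm₁, hs₂ hm₂⟩
      rcases Finset.mem_insert.1 hx with rfl | hx
      · exact ⟨hs₃ hm₃, hs₄ hm₄⟩
      obtain ⟨w, hw, rfl⟩ := Finset.mem_image.1 hx
      simp only [hU, Finset.mem_union] at hw
      rcases hw with (hw | hw) | (hw | hw)
      exacts [⟨hs₁ (hcl₁ w hw).1, hs₁ (hcl₁ w hw).2⟩, ⟨hs₂ (hcl₂ w hw).1, hs₂ (hcl₂ w hw).2⟩,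
        ⟨hs₃ (hcl₃ w hw).1, hs₃ (hcl₃ w hw).2⟩, ⟨hs₄ (hcl₄ w hw).1, hs₄ (hcl₄ w hw).2⟩]
    have himg : U.image p ⊆ (B.erase v).image p := Finset.image_subset_image hUB
    have hcard := Finset.card_le_card hsub
    rw [Finset.card_insert_of_notMem, Finset.card_insert_of_notMem fun h => hf.2 (himg h),
      Finset.card_image_of_injOn (hinj.mono (Finset.coe_subset.2 hUB))] at hcard
    · rw [Finset.card_insert_of_notMem hvU]
      omega
    · intro h
      rcases Finset.mem_insert.1 h with h | h
      exacts [hef h, he.2 (himg h)]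

/-- A ball inside `W` can be enlarged so that it spans all edges of `W` incident to it. -/
theorem IsRootedBall.exists_grow {W B : Finset V} {r : ℕ} {c : ℝ} (h : IsRootedBall ends v B r)
    (hBW : B ⊆ W) (hW : c * W.card < (inducedEdges ends W).card)
    (hmin : ∀ S ⊂ W, ((inducedEdges ends S).card : ℝ) ≤ c * S.card) :
    ∃ B' ⊆ W, IsRootedBall ends v B' (r + 1) ∧ c * B.card < (inducedEdges ends B').card := by
  classical
  set B' := B ∪ W.filter (fun u => ∃ e, ∃ b ∈ B, ends e = (u, b) ∨ ends e = (b, u)) with hB'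
  refine ⟨B', Finset.union_subset hBW (Finset.filter_subset _ _),
    h.extend Finset.subset_union_left ?_, ?_⟩
  · intro u hu huB
    rcases Finset.mem_union.1 hu with hu | hu
    exacts [(huB hu).elim, (Finset.mem_filter.1 hu).2]
  · have hss : W \ B ⊂ W := Finset.sdiff_ssubset hBW ⟨v, h.1⟩
    have hcov : inducedEdges ends W ⊆ inducedEdges ends (W \ B) ∪ inducedEdges ends B' := by
      intro e he
      simp only [inducedEdges, Finset.mem_union, Finset.mem_filter, Finset.mem_univ, true_and,
        Finset.mem_sdiff, hB'] at he ⊢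
      by_cases h1 : (ends e).1 ∈ B
      · exact Or.inr ⟨Or.inl h1, Or.inr ⟨he.2, e, _, h1, Or.inr rfl⟩⟩
      by_cases h2 : (ends e).2 ∈ B
      · exact Or.inr ⟨Or.inr ⟨he.1, e, _, h2, Or.inl rfl⟩, Or.inl h2⟩
      exact Or.inl ⟨⟨he.1, h1⟩, he.2, h2⟩
    have h1 : ((inducedEdges ends W).card : ℝ) ≤
        (inducedEdges ends (W \ B)).card + (inducedEdges ends B').card := by
      exact_mod_cast (Finset.card_le_card hcov).trans (Finset.card_union_le _ _)
    have h2 := hmin _ hss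
    have h3 : ((W \ B).card : ℝ) + B.card = W.card := by
      exact_mod_cast Finset.card_sdiff_add_card_eq_card hBW
    rw [← h3] at hW
    linarith

/-- In a minimal set `W` with more than `c * |W|` edges, rooted balls either grow geometrically
with ratio `c` or yield a small set with more edges than vertices. -/
theorem exists_dense_or_isRootedBall {W : Finset V} {c : ℝ} (hc : 0 ≤ c) (hv : v ∈ W)
    (hW : c * W.card < (inducedEdges ends W).card)
    (hmin : ∀ S ⊂ W, ((inducedEdges ends S).card : ℝ) ≤ c * S.card) (k : ℕ) :
    (∃ X : Finset V, X.card ≤ 4 * k + 1 ∧ X.card < (inducedEdges ends X).card) ∨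
      ∃ B ⊆ W, IsRootedBall ends v B k ∧ c ^ k ≤ B.card := by
  induction k with
  | zero =>
    have : (0 : ℝ) < (inducedEdges ends W).card := lt_of_le_of_lt (by positivity) hW
    obtain ⟨e, -⟩ := Finset.card_pos.1 (Nat.cast_pos.1 this)
    have : Nonempty ι := ⟨e⟩
    exact Or.inr ⟨{v}, by simpa using hv, isRootedBall_singleton, by simp⟩
  | succ k ih =>
    rcases ih with ⟨X, hX, hX'⟩ | ⟨B, hBW, hB, hcard⟩
    · exact Or.inl ⟨X, by omega, hX'⟩
    obtain ⟨B', hBW', hB', hlt⟩ := hB.exists_grow hBW hW hmin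
    rcases lt_or_ge B'.card (inducedEdges ends B').card with hd | hd
    · exact Or.inl (hB'.exists_dense hd)
    · refine Or.inr ⟨B', hBW', hB', ?_⟩
      have : ((inducedEdges ends B').card : ℝ) ≤ B'.card := by exact_mod_cast hd
      calc c ^ (k + 1) = c * c ^ k := pow_succ' c k
        _ ≤ c * B.card := by gcongr
        _ ≤ B'.card := by linarith

end RootedBall

theorem le_four_mul_logb_two_of_le_sixteen {n : ℕ} (hn2 : 2 ≤ n) (hn : n ≤ 16) :
    (n : ℝ) ≤ 4 * Real.logb 2 n := by
  have h : 2 ^ n ≤ n ^ 4 := by interval_cases n <;> norm_num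
  have hn0 : (0 : ℝ) < n := by exact_mod_cast (by omega : 0 < n)
  have h1 : ((2 : ℝ) ^ n) ≤ (n : ℝ) ^ 4 := by exact_mod_cast h
  have h2 := Real.logb_le_logb_of_le (b := 2) (by norm_num) (by positivity) h1
  rw [Real.logb_pow, Real.logb_pow, Real.logb_self_eq_one (by norm_num)] at h2
  push_cast at h2
  linarith

theorem lt_logb_two_of_seventeen_le {n : ℕ} (hn : 17 ≤ n) : (53 / 13 : ℝ) ≤ Real.logb 2 n := by
  have h0 : (2 : ℝ) ^ 53 ≤ (n : ℝ) ^ 13 :=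
    calc (2 : ℝ) ^ 53 ≤ 17 ^ 13 := by norm_num
      _ ≤ (n : ℝ) ^ 13 := by gcongr; exact_mod_cast hn
  have h2 := Real.logb_le_logb_of_le (b := 2) (by norm_num) (by positivity) h0
  rw [Real.logb_pow, Real.logb_pow, Real.logb_self_eq_one (by norm_num)] at h2
  push_cast at h2
  linarith

/-- Some `k` with `(1 + ε) ^ k > n` satisfies `4 * k + 1 ≤ 4 * (1 + 1 / ε) * log₂ n`. -/
theorem exists_lt_pow_and_le_logb {ε : ℝ} (hε : 0 < ε) {n : ℕ} (hn : 17 ≤ n) :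
    ∃ k : ℕ, (n : ℝ) < (1 + ε) ^ k ∧
      ((4 * k + 1 : ℕ) : ℝ) ≤ 4 * (1 + 1 / ε) * Real.logb 2 n := by
  have hn0 : (0 : ℝ) < n := by exact_mod_cast (by omega : 0 < n)
  have hL := lt_logb_two_of_seventeen_le hn
  set L := Real.logb 2 n with hLdef
  have hlogn : Real.log n = L * Real.log 2 := by
    rw [hLdef, Real.logb, div_mul_cancel₀ _ (Real.log_pos (by norm_num)).ne']
  have hlog2 := Real.log_two_lt_d9
  have hlog2pos : 0 < Real.log 2 := Real.log_pos (by norm_num)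
  have hlogε : 0 < Real.log (1 + ε) := Real.log_pos (by linarith)
  have hinv : 1 / Real.log (1 + ε) ≤ 1 + 1 / ε := by
    have h1 := Real.one_sub_inv_le_log_of_pos (show 0 < 1 + ε by linarith)
    have h2 : 1 - (1 + ε)⁻¹ = 1 / (1 + 1 / ε) := by field_simp; ring
    rw [h2] at h1
    rw [one_div_le hlogε (by positivity)]
    exact h1
  have hk := Nat.lt_floor_add_one (Real.log n / Real.log (1 + ε))
  have hkle := Nat.floor_le (show 0 ≤ Real.log n / Real.log (1 + ε) by
    rw [hlogn]; positivity)
  refine ⟨⌊Real.log n / Real.log (1 + ε)⌋₊ + 1, ?_, ?_⟩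
  · rw [← Real.log_lt_log_iff hn0 (by positivity), Real.log_pow]
    rw [div_lt_iff₀ hlogε] at hk
    exact_mod_cast hk
  · have h3 : Real.log n / Real.log (1 + ε) ≤ (1 + 1 / ε) * (L * Real.log 2) := by
      rw [← hlogn, div_eq_mul_one_div, mul_comm]
      exact mul_le_mul_of_nonneg_right hinv (by rw [hlogn]; positivity)
    have h4 : 1 ≤ 1 + 1 / ε := by
      have : 0 < 1 / ε := by positivity
      linarith
    have h5 : 5 ≤ 4 * (L * (1 - Real.log 2)) := by
      have : (53 / 13 : ℝ) * (1 - 0.6931471808) ≤ L * (1 - Real.log 2) :=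
        mul_le_mul hL (by linarith) (by norm_num) (by linarith)
      norm_num at this ⊢
      linarith
    have h6 : 5 ≤ (1 + 1 / ε) * (4 * (L * (1 - Real.log 2))) := by nlinarith
    push_cast
    linarith


/-- A multigraph is encoded by an edge-index type `ι` with endpoint
map `ends : ι → V × V` (loops and parallel edges allowed).  Let `ε > 0`.  If there is
no vertex subset `X` with `|X| ≤ 4·(1 + 1/ε)·log₂ n` such that the induced subgraph
`G[X]` has more edges than vertices, then `|E| ≤ (1+ε)·|V|`. -/
theorem stmt_2 {V ι : Type*} [Fintype V] [DecidableEq V] [Fintype ι]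
    (ends : ι → V × V) (ε : ℝ) (hε : 0 < ε)
    (n : ℕ) (hn : n = Fintype.card V) (hn2 : 2 ≤ n)
    (hno : ¬ ∃ X : Finset V,
      (X.card : ℝ) ≤ 4 * (1 + 1 / ε) * Real.logb 2 n ∧
      X.card < (Finset.univ.filter (fun e : ι => (ends e).1 ∈ X ∧ (ends e).2 ∈ X)).card) :
    (Fintype.card ι : ℝ) ≤ (1 + ε) * Fintype.card V := by
  classical
  change ¬ ∃ X : Finset V, (X.card : ℝ) ≤ 4 * (1 + 1 / ε) * Real.logb 2 n ∧
    X.card < (inducedEdges ends X).card at hno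
  push Not at hno
  have huniv : inducedEdges ends Finset.univ = Finset.univ := by simp [inducedEdges]
  by_contra! hcon
  have hn17 : 17 ≤ n := by
    by_contra! hlt
    have hle := le_four_mul_logb_two_of_le_sixteen hn2 (by omega)
    have hn0 : (0 : ℝ) ≤ n := n.cast_nonneg
    have hpos : 0 < 1 / ε := by positivity
    have h1 := hno Finset.univ (by rw [Finset.card_univ, ← hn]; nlinarith)
    rw [huniv, Finset.card_univ, Finset.card_univ] at h1
    have h2 : (Fintype.card ι : ℝ) ≤ Fintype.card V := by exact_mod_cast h1
    have h3 : (0 : ℝ) ≤ Fintype.card V := Nat.cast_nonneg _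
    nlinarith
  obtain ⟨k, hnk, hk⟩ := exists_lt_pow_and_le_logb hε hn17
  obtain ⟨W, hWmem, hWmin⟩ := Finset.exists_min_image
    (Finset.univ.filter fun W : Finset V => (1 + ε) * W.card < (inducedEdges ends W).card)
    Finset.card ⟨Finset.univ, by simpa [huniv] using hcon⟩
  have hW := (Finset.mem_filter.1 hWmem).2
  have hmin : ∀ S ⊂ W, ((inducedEdges ends S).card : ℝ) ≤ (1 + ε) * S.card := by
    intro S hS
    by_contra! hlt
    exact (Finset.card_lt_card hS).not_ge (hWmin S (by simpa using hlt))
  obtain ⟨v, hv⟩ : W.Nonempty := by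
    rw [Finset.nonempty_iff_ne_empty]
    rintro rfl
    simp [inducedEdges] at hW
  rcases exists_dense_or_isRootedBall (by linarith) hv hW hmin k with
    ⟨X, hX, hX'⟩ | ⟨B, -, -, hB⟩
  · exact hX'.not_ge (hno X (le_trans (by exact_mod_cast hX) hk))
  · have : (B.card : ℝ) ≤ n := by
      rw [hn]
      exact_mod_cast B.card_le_univ
    linarith
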